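/- Let p ≥ 2 and m ≥ 1 be integers and ζ = exp(2π√−1/p). Let c ∈ ℂ^m satisfy ∏_{(i_1,…,i_m)∈{0,…,p−1}^m}(1 − ζ^{i_1}c_1 − ⋯ − ζ^{i_m}c_m) ≠ 0. In ℂ[ξ_1,…,ξ_m], set M_k = ξ_k^p − ξ_m^p for 1 ≤ k ≤ m−1 and M_m = ξ_m^p − (c_1ξ_1 + ⋯ + c_mξ_m)^p. Then the quotient ring ℂ[ξ_1,…,ξ_m]/(M_1,…,M_m) is a ℂ-vector space of dimension exactly p^m. -/

import Mathlib

set_option synthInstance.maxHeartbeats 400000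

open scoped BigOperators
open MvPolynomial
open scoped Matrix

theorem finrank_quotient_eq_of_injective {K P V : Type*} [Field K] [AddCommGroup P] [Module K P]
    [AddCommGroup V] [Module K V] (φ : P →ₗ[K] V) (F : V →ₗ[K] V) (hF : Function.Injective F)
    (I : Submodule K P) (hI : I = ((LinearMap.range φ).map F).comap φ)
    (hle : (LinearMap.range φ).map F ≤ LinearMap.range φ)
    [FiniteDimensional K (V ⧸ LinearMap.range φ)] [FiniteDimensional K (V ⧸ LinearMap.range F)] :
    Module.finrank K (P ⧸ I) = Module.finrank K (V ⧸ LinearMap.range F) := by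
  set W := LinearMap.range φ with hW
  set U := W.map F with hU
  have hUF : U ≤ LinearMap.range F := LinearMap.map_le_range
  let a : (P ⧸ I) →ₗ[K] V ⧸ U := I.mapQ U φ hI.le
  let b : (V ⧸ U) →ₗ[K] V ⧸ W := Submodule.factor hle
  let a' : (V ⧸ W) →ₗ[K] V ⧸ U := W.mapQ U F (Submodule.le_comap_map F W)
  let b' : (V ⧸ U) →ₗ[K] V ⧸ LinearMap.range F := Submodule.factor hUF
  have ha : Function.Injective a := by
    rw [← LinearMap.ker_eq_bot, Submodule.ker_mapQ, hI, Submodule.mkQ_map_self]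
  have ha' : Function.Injective a' := by
    rw [← LinearMap.ker_eq_bot, Submodule.ker_mapQ, hU, Submodule.comap_map_eq_of_injective hF,
      Submodule.mkQ_map_self]
  have hb : Function.Surjective b := Submodule.factor_surjective hle
  have hb' : Function.Surjective b' := Submodule.factor_surjective hUF
  have hab : LinearMap.range a = LinearMap.ker b := by
    rw [Submodule.range_mapQ, Submodule.ker_mapQ]
    rfl
  have hab' : LinearMap.range a' = LinearMap.ker b' := by
    rw [Submodule.range_mapQ, Submodule.ker_mapQ]
    rfl
  have : FiniteDimensional K (LinearMap.ker b') := hab' ▸ inferInstance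
  have : FiniteDimensional K ((V ⧸ U) ⧸ LinearMap.ker b') :=
    Module.Finite.equiv (b'.quotKerEquivOfSurjective hb').symm
  have : FiniteDimensional K (V ⧸ U) := Module.Finite.of_submodule_quotient (LinearMap.ker b')
  have h1 := LinearMap.finrank_range_add_finrank_ker b
  have h2 := LinearMap.finrank_range_add_finrank_ker b'
  rw [LinearMap.range_eq_top.2 hb, finrank_top, ← hab, LinearMap.finrank_range_of_inj ha] at h1
  rw [LinearMap.range_eq_top.2 hb', finrank_top, ← hab', LinearMap.finrank_range_of_inj ha'] at h2
  omega

/-- The first `N` coefficients of each member of a family of polynomials. -/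
noncomputable def truncCoeff (ι K : Type*) [Field K] (N : ℕ) :
    (ι → Polynomial K) →ₗ[K] (ι → Fin N → K) :=
  LinearMap.pi fun i => LinearMap.pi fun t => Polynomial.lcoeff K t ∘ₗ LinearMap.proj i

theorem mem_ker_truncCoeff {ι K : Type*} [Field K] {N : ℕ} {g : ι → Polynomial K} :
    g ∈ LinearMap.ker (truncCoeff ι K N) ↔ ∀ i, Polynomial.X ^ N ∣ g i := by
  simp only [LinearMap.mem_ker, Polynomial.X_pow_dvd_iff, funext_iff]
  exact ⟨fun h i d hd => h i ⟨d, hd⟩, fun h i t => h i t t.2⟩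

theorem truncCoeff_surjective (ι K : Type*) [Field K] (N : ℕ) :
    Function.Surjective (truncCoeff ι K N) := by
  intro y
  refine ⟨fun i => ∑ t : Fin N, Polynomial.monomial t (y i t), ?_⟩
  ext i t
  simp [truncCoeff, Polynomial.coeff_monomial, Fin.val_inj]

theorem finiteDimensional_quotient_of_ker_le {K V E : Type*} [Field K] [AddCommGroup V]
    [Module K V] [AddCommGroup E] [Module K E] [FiniteDimensional K E] (t : V →ₗ[K] E)
    (W : Submodule K V) (h : LinearMap.ker t ≤ W) : FiniteDimensional K (V ⧸ W) :=
  have : FiniteDimensional K (V ⧸ LinearMap.ker t) := Module.Finite.equiv t.quotKerEquivRange.symm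
  Module.Finite.of_surjective _ (Submodule.factor_surjective h)

theorem range_mulLeft_eq_ker_truncCoeff {ι K : Type*} [Field K] {p : ℕ} (u : ι → K)
    (hu : ∀ i, u i ≠ 0) :
    LinearMap.range (LinearMap.mulLeft K fun i => Polynomial.C (u i) * Polynomial.X ^ p) =
      LinearMap.ker (truncCoeff ι K p) := by
  ext g
  rw [mem_ker_truncCoeff]
  constructor
  · rintro ⟨h, rfl⟩ i
    exact ⟨Polynomial.C (u i) * h i, by simp; ring⟩
  · intro h
    choose q hq using h
    refine ⟨fun i => Polynomial.C (u i)⁻¹ * q i, ?_⟩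
    ext1 i
    have : Polynomial.C (u i) * Polynomial.C (u i)⁻¹ = 1 := by
      rw [← Polynomial.C_mul, mul_inv_cancel₀ (hu i), Polynomial.C_1]
    simp only [LinearMap.mulLeft_apply, Pi.mul_apply, hq i]
    linear_combination (Polynomial.X ^ p * q i) * this

theorem sum_pow_eq_ite {K : Type*} [Field K] {p : ℕ} {ζ : K} (hζ : IsPrimitiveRoot ζ p)
    (i j : Fin p) :
    ∑ t : Fin p, (ζ ^ (i : ℕ) * ζ⁻¹ ^ (j : ℕ)) ^ (t : ℕ) = if i = j then (p : K) else 0 := by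
  have hp : p ≠ 0 := (Fin.pos i).ne'
  have h0 : ζ ≠ 0 := hζ.ne_zero hp
  split_ifs with h
  · subst h
    rw [inv_pow, mul_inv_cancel₀ (pow_ne_zero _ h0)]
    simp
  · set w := ζ ^ (i : ℕ) * ζ⁻¹ ^ (j : ℕ) with hw
    have hw1 : w ≠ 1 := by
      intro h1
      apply h
      rw [hw, inv_pow, mul_inv_eq_one₀ (pow_ne_zero _ h0)] at h1
      exact Fin.ext (hζ.pow_inj i.2 j.2 h1)
    have hwp : w ^ p = 1 := by
      rw [hw, mul_pow, ← pow_mul, ← pow_mul, mul_comm _ p, mul_comm _ p, pow_mul, pow_mul, inv_pow,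
        hζ.pow_eq_one]
      simp
    rw [Fin.sum_univ_eq_sum_range (fun t => w ^ t), geom_sum_eq hw1, hwp]
    simp

/-- The character table of `(ℤ/p)ⁿ` built from `ζ`. -/
def charTable {K : Type*} [Field K] (n p : ℕ) (ζ : K) : Matrix (Fin n → Fin p) (Fin n → Fin p) K :=
  fun i a => ∏ k, (ζ ^ (i k : ℕ)) ^ (a k : ℕ)

theorem exists_charTable_mul_eq_one {K : Type*} [Field K] [CharZero K] (n : ℕ) {p : ℕ} (hp : p ≠ 0)
    {ζ : K} (hζ : IsPrimitiveRoot ζ p) :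
    ∃ T : Matrix (Fin n → Fin p) (Fin n → Fin p) K,
      charTable n p ζ * T = 1 ∧ T * charTable n p ζ = 1 := by
  suffices h : ∃ T, charTable n p ζ * T = 1 by
    obtain ⟨T, hT⟩ := h
    exact ⟨T, hT, mul_eq_one_comm.1 hT⟩
  let T : Matrix (Fin n → Fin p) (Fin n → Fin p) K :=
    fun a j => ((p : K) ^ n)⁻¹ * ∏ k, (ζ⁻¹ ^ (j k : ℕ)) ^ (a k : ℕ)
  refine ⟨T, ?_⟩
  ext i j
  have hpn : (p : K) ^ n ≠ 0 := pow_ne_zero _ (Nat.cast_ne_zero.2 hp)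
  have key : ∑ a : Fin n → Fin p, ∏ k, (ζ ^ (i k : ℕ) * ζ⁻¹ ^ (j k : ℕ)) ^ (a k : ℕ) =
      if i = j then (p : K) ^ n else 0 := by
    rw [← Fintype.prod_sum (fun k (t : Fin p) => (ζ ^ (i k : ℕ) * ζ⁻¹ ^ (j k : ℕ)) ^ (t : ℕ))]
    simp only [sum_pow_eq_ite hζ]
    split_ifs with h
    · simp [h]
    · obtain ⟨k, hk⟩ := Function.ne_iff.1 h
      exact Finset.prod_eq_zero (Finset.mem_univ k) (if_neg hk)
  have : (charTable n p ζ * T) i j =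
      ((p : K) ^ n)⁻¹ *
        ∑ a : Fin n → Fin p, ∏ k, (ζ ^ (i k : ℕ) * ζ⁻¹ ^ (j k : ℕ)) ^ (a k : ℕ) := by
    rw [Matrix.mul_apply, Finset.mul_sum]
    refine Finset.sum_congr rfl fun a _ => ?_
    simp only [charTable, T, mul_pow, Finset.prod_mul_distrib]
    ring
  rw [this, key, Matrix.one_apply]
  split_ifs <;> simp [hpn]

/-- Restriction of a polynomial to the lines through the origin spanned by
`(ζ ^ i₁, …, ζ ^ iₙ, 1)`. -/
noncomputable def restrictLines {K : Type*} [Field K] (n p : ℕ) (ζ : K) :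
    MvPolynomial (Fin (n + 1)) K →ₐ[K] ((Fin n → Fin p) → Polynomial K) :=
  AlgHom.pi fun i => aeval fun k =>
    Polynomial.C ((Fin.snoc (fun k => ζ ^ (i k : ℕ)) 1 : Fin (n + 1) → K) k) * Polynomial.X

/-- The combination `∑ a, g a * ξ₁ ^ a₁ ⋯ ξₙ ^ aₙ` with coefficients polynomials in the last
variable. -/
noncomputable def normalForm {K : Type*} [Field K] {n p : ℕ} (g : (Fin n → Fin p) → Polynomial K) :
    MvPolynomial (Fin (n + 1)) K :=
  ∑ a, Polynomial.aeval (X (Fin.last n)) (g a) * ∏ k, X k.castSucc ^ (a k : ℕ)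

theorem restrictLines_normalForm {K : Type*} [Field K] {n p : ℕ} (ζ : K)
    (g : (Fin n → Fin p) → Polynomial K) (i : Fin n → Fin p) :
    restrictLines n p ζ (normalForm g) i =
      ∑ a, Polynomial.C (charTable n p ζ i a) * (g a * Polynomial.X ^ ∑ k, (a k : ℕ)) := by
  simp only [restrictLines, normalForm, AlgHom.pi_apply, map_sum, map_mul, map_prod, map_pow,
    aeval_X, Fin.snoc_castSucc, mul_pow,
    Finset.prod_mul_distrib, Finset.prod_pow_eq_pow_sum, charTable]
  refine Finset.sum_congr rfl fun a _ => ?_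
  rw [← Polynomial.aeval_algHom_apply]
  simp
  ring

theorem exists_normalForm_sub_mem {K : Type*} [Field K] {n p : ℕ} (hp : p ≠ 0)
    (J : Ideal (MvPolynomial (Fin (n + 1)) K))
    (hJ : ∀ k : Fin n, X k.castSucc ^ p - X (Fin.last n) ^ p ∈ J)
    (q : MvPolynomial (Fin (n + 1)) K) :
    ∃ g : (Fin n → Fin p) → Polynomial K, q - normalForm g ∈ J := by
  induction q using MvPolynomial.induction_on' with
  | add q r hq hr =>
    obtain ⟨g, hg⟩ := hq
    obtain ⟨h, hh⟩ := hr
    refine ⟨g + h, ?_⟩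
    have : normalForm (g + h) = normalForm g + normalForm h := by
      simp [normalForm, add_mul, Finset.sum_add_distrib]
    rw [this, add_sub_add_comm]
    exact J.add_mem hg hh
  | monomial s r =>
    let a : Fin n → Fin p := fun k => ⟨s k.castSucc % p, Nat.mod_lt _ (Nat.pos_of_ne_zero hp)⟩
    refine ⟨Pi.single a (Polynomial.C r * Polynomial.X ^ s (Fin.last n) *
      ∏ k : Fin n, (Polynomial.X ^ p) ^ (s k.castSucc / p)), ?_⟩
    have hn : ∀ f, normalForm (Pi.single a f) =
        Polynomial.aeval (X (Fin.last n)) f * ∏ k : Fin n, (X k.castSucc : MvPolynomial (Fin (n + 1)) K) ^ (s k.castSucc % p) := by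
      intro f
      rw [normalForm, Finset.sum_eq_single a]
      · simp [a]
      · intro b _ hb
        simp [Pi.single_eq_of_ne hb]
      · simp
    have hJ' : ∀ k : Fin n, Ideal.Quotient.mk J (X k.castSucc) ^ p =
        Ideal.Quotient.mk J (X (Fin.last n)) ^ p := by
      intro k
      rw [← map_pow, ← map_pow]
      exact Ideal.Quotient.eq.2 (hJ k)
    rw [← Ideal.Quotient.eq, hn, monomial_eq, Finsupp.prod_fintype _ _ (by simp),
      Fin.prod_univ_castSucc]
    simp only [map_mul, map_prod, map_pow, Polynomial.aeval_X, Polynomial.aeval_C]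
    have : ∀ k : Fin n, Ideal.Quotient.mk J (X k.castSucc) ^ s k.castSucc =
        (Ideal.Quotient.mk J (X k.castSucc) ^ p) ^ (s k.castSucc / p) *
          Ideal.Quotient.mk J (X k.castSucc) ^ (s k.castSucc % p) := by
      intro k
      rw [← pow_mul, ← pow_add, Nat.div_add_mod]
    simp only [this, Finset.prod_mul_distrib, algebraMap_eq, hJ']
    ring

theorem ker_restrictLines_le {K : Type*} [Field K] [CharZero K] {n p : ℕ} (hp : p ≠ 0) {ζ : K}
    (hζ : IsPrimitiveRoot ζ p) (J : Ideal (MvPolynomial (Fin (n + 1)) K))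
    (hJ : ∀ k : Fin n, X k.castSucc ^ p - X (Fin.last n) ^ p ∈ J)
    (hJker : J ≤ RingHom.ker (restrictLines n p ζ)) : RingHom.ker (restrictLines n p ζ) ≤ J := by
  intro q hq
  obtain ⟨g, hg⟩ := exists_normalForm_sub_mem hp J hJ q
  have h0 : restrictLines n p ζ (normalForm g) = 0 := by
    have := hJker hg
    rw [RingHom.mem_ker] at this hq
    rwa [map_sub, hq, zero_sub, neg_eq_zero] at this
  obtain ⟨T, -, hT⟩ := exists_charTable_mul_eq_one n hp hζ
  have hg0 : g = 0 := by
    have hvec : (charTable n p ζ).map Polynomial.C *ᵥ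
        (fun a => g a * Polynomial.X ^ ∑ k, (a k : ℕ)) = 0 := by
      ext1 i
      rw [← h0, restrictLines_normalForm]
      rfl
    have h1 := congrArg (T.map Polynomial.C *ᵥ ·) hvec
    simp only [Matrix.mulVec_mulVec, ← Matrix.map_mul, hT, Matrix.mulVec_zero] at h1
    rw [Matrix.map_one _ (map_zero _) (map_one _), Matrix.one_mulVec] at h1
    ext1 a
    exact (mul_eq_zero.1 (congrFun h1 a)).resolve_right (pow_ne_zero _ Polynomial.X_ne_zero)
  simpa [hg0, normalForm] using hg

theorem ker_truncCoeff_le_range_restrictLines {K : Type*} [Field K] [CharZero K] {n p : ℕ}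
    (hp : p ≠ 0) {ζ : K} (hζ : IsPrimitiveRoot ζ p) :
    LinearMap.ker (truncCoeff (Fin n → Fin p) K (n * p)) ≤
      LinearMap.range (restrictLines n p ζ).toLinearMap := by
  intro f hf
  rw [mem_ker_truncCoeff] at hf
  choose h hh using hf
  obtain ⟨T, hT, -⟩ := exists_charTable_mul_eq_one n hp hζ
  have hdeg : ∀ a : Fin n → Fin p, ∑ k, (a k : ℕ) ≤ n * p := fun a =>
    (Finset.sum_le_card_nsmul _ _ p fun k _ => (a k).2.le).trans (by simp)
  refine ⟨normalForm fun a => Polynomial.X ^ (n * p - ∑ k, (a k : ℕ)) *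
    (T.map Polynomial.C *ᵥ h) a, ?_⟩
  ext1 i
  rw [AlgHom.toLinearMap_apply, restrictLines_normalForm]
  have hmul : (charTable n p ζ).map Polynomial.C *ᵥ (T.map Polynomial.C *ᵥ h) = h := by
    rw [Matrix.mulVec_mulVec, ← Matrix.map_mul, hT, Matrix.map_one _ (map_zero _) (map_one _),
      Matrix.one_mulVec]
  rw [hh i]
  conv_rhs => rw [← hmul]
  rw [Matrix.mulVec, dotProduct, Finset.mul_sum]
  refine Finset.sum_congr rfl fun a _ => ?_
  rw [← Nat.sub_add_cancel (hdeg a), pow_add]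
  simp only [Matrix.map_apply, Nat.add_sub_cancel]
  ring

theorem sum_mul_pow_ne_one {K : Type*} [Field K] {m p : ℕ} (hp : p ≠ 0) {ζ : K}
    (hζ : IsPrimitiveRoot ζ p) (c : Fin m → K)
    (hcR : ∏ i : Fin m → Fin p, (1 - ∑ k : Fin m, ζ ^ (i k : ℕ) * c k) ≠ 0)
    (η : Fin m → K) (hη : ∀ k, η k ^ p = 1) : (∑ k, η k * c k) ^ p ≠ 1 := by
  intro h
  have : NeZero p := ⟨hp⟩
  set L := ∑ k, η k * c k with hL
  have hL0 : L ≠ 0 := by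
    rintro h0
    simp [h0, hp] at h
  have hr : ∀ k, ∃ t : Fin p, ζ ^ (t : ℕ) = η k * L⁻¹ := by
    intro k
    obtain ⟨t, ht, h'⟩ := hζ.eq_pow_of_pow_eq_one (ξ := η k * L⁻¹) (by
      rw [mul_pow, hη, inv_pow, h]; simp)
    exact ⟨⟨t, ht⟩, h'⟩
  choose t ht using hr
  refine hcR (Finset.prod_eq_zero (Finset.mem_univ t) ?_)
  have : ∑ k, ζ ^ (t k : ℕ) * c k = L * L⁻¹ := by
    rw [hL, Finset.sum_mul]
    refine Finset.sum_congr rfl fun k _ => ?_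
    rw [ht]
    ring
  rw [this, mul_inv_cancel₀ hL0, sub_self]

/-- for any point `c` lying off the pulled-back singular locus `R(z) = 0`,
the quotient `ℂ[ξ_1,…,ξ_m]/(ξ_1^p − ξ_m^p, …, ξ_{m−1}^p − ξ_m^p, ξ_m^p − (Σ c_jξ_j)^p)`
has dimension exactly `p^m` over `ℂ`. -/
theorem FCpm_symbol_quotient_finrank (p m : ℕ) (hp : 2 ≤ p) (hm : 1 ≤ m) (ζ : ℂ)
    (hζ : ζ = Complex.exp (2 * Real.pi * Complex.I / p))
    (c : Fin m → ℂ)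
    (hcR : ∏ i : Fin m → Fin p, (1 - ∑ k : Fin m, ζ ^ (i k : ℕ) * c k) ≠ 0)
    (M : Fin m → MvPolynomial (Fin m) ℂ)
    (hM : ∀ k : Fin m, M k =
      if (k : ℕ) < m - 1 then
        X k ^ p - X (⟨m - 1, by omega⟩ : Fin m) ^ p
      else
        X (⟨m - 1, by omega⟩ : Fin m) ^ p - (∑ j : Fin m, C (c j) * X j) ^ p) :
    Module.finrank ℂ (MvPolynomial (Fin m) ℂ ⧸ Ideal.span (Set.range M)) = p ^ m := by
  obtain ⟨n, rfl⟩ : ∃ n, m = n + 1 := ⟨m - 1, by omega⟩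
  have hp0 : p ≠ 0 := by omega
  have hprim : IsPrimitiveRoot ζ p := hζ ▸ Complex.isPrimitiveRoot_exp p hp0
  have hMcast : ∀ k : Fin n, M k.castSucc = X k.castSucc ^ p - X (Fin.last n) ^ p := by
    intro k
    rw [hM, if_pos (by simp)]
    rfl
  have hMlast : M (Fin.last n) =
      X (Fin.last n) ^ p - (∑ j : Fin (n + 1), C (c j) * X j) ^ p := by
    rw [hM, if_neg (by simp)]
    rfl
  set Φ := restrictLines n p ζ with hΦ
  let η : (Fin n → Fin p) → Fin (n + 1) → ℂ := fun i => Fin.snoc (fun k => ζ ^ (i k : ℕ)) 1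
  have hη : ∀ i k, η i k ^ p = 1 := by
    intro i k
    refine Fin.lastCases ?_ (fun k => ?_) k
    · simp [η]
    · simp only [η, Fin.snoc_castSucc]
      rw [← pow_mul, mul_comm, pow_mul, hprim.pow_eq_one, one_pow]
  have hΦX : ∀ i k, Φ (X k) i = Polynomial.C (η i k) * Polynomial.X := by
    intro i k
    simp [hΦ, restrictLines, η]
  have hΦX' : ∀ k, Φ (X k ^ p) = fun _ => Polynomial.X ^ p := by
    intro k
    ext1 i
    rw [map_pow, Pi.pow_apply, hΦX, mul_pow, ← Polynomial.C_pow, hη, Polynomial.C_1, one_mul]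
  let u : (Fin n → Fin p) → ℂ := fun i => 1 - (∑ k, η i k * c k) ^ p
  have hu : ∀ i, u i ≠ 0 := fun i =>
    sub_ne_zero.2 (sum_mul_pow_ne_one hp0 hprim c hcR (η i) (hη i)).symm
  have hΦlast : Φ (M (Fin.last n)) = fun i => Polynomial.C (u i) * Polynomial.X ^ p := by
    rw [hMlast, map_sub, hΦX']
    ext1 i
    have : Φ (∑ j, C (c j) * X j) i = Polynomial.C (∑ k, η i k * c k) * Polynomial.X := by
      have hC : ∀ r, Φ (C r) i = Polynomial.C r := fun r => by
        simp [hΦ, restrictLines, Polynomial.algebraMap_eq]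
      simp only [map_sum, map_mul, Finset.sum_apply, Pi.mul_apply, hC, hΦX, Finset.sum_mul]
      exact Finset.sum_congr rfl fun k _ => by ring
    rw [Pi.sub_apply, map_pow, Pi.pow_apply, this]
    simp only [u, map_sub, map_pow, map_one]
    ring
  let J : Ideal (MvPolynomial (Fin (n + 1)) ℂ) :=
    Ideal.span (Set.range fun k : Fin n => M k.castSucc)
  have hJker : J ≤ RingHom.ker Φ := by
    rw [Ideal.span_le]
    rintro _ ⟨k, rfl⟩
    simp only [SetLike.mem_coe, RingHom.mem_ker]
    rw [hMcast, map_sub, hΦX', hΦX', sub_self]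
  have hker : RingHom.ker Φ ≤ J := ker_restrictLines_le hp0 hprim J
    (fun k => hMcast k ▸ Ideal.subset_span ⟨k, rfl⟩) hJker
  have hJle : J ≤ Ideal.span (Set.range M) :=
    Ideal.span_mono (by rintro _ ⟨k, rfl⟩; exact ⟨_, rfl⟩)
  let F := LinearMap.mulLeft ℂ (Φ (M (Fin.last n)))
  have hFrange : LinearMap.range F = LinearMap.ker (truncCoeff (Fin n → Fin p) ℂ p) := by
    rw [← range_mulLeft_eq_ker_truncCoeff u hu, ← hΦlast]
  have hFinj : Function.Injective F := by
    intro g h hgh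
    ext1 i
    have := congrFun hgh i
    simp only [F, LinearMap.mulLeft_apply, Pi.mul_apply, hΦlast] at this
    exact mul_left_cancel₀ (mul_ne_zero (Polynomial.C_ne_zero.2 (hu i))
      (pow_ne_zero _ Polynomial.X_ne_zero)) this
  have : FiniteDimensional ℂ (_ ⧸ LinearMap.range Φ.toLinearMap) :=
    finiteDimensional_quotient_of_ker_le _ _ (ker_truncCoeff_le_range_restrictLines hp0 hprim)
  have : FiniteDimensional ℂ (_ ⧸ LinearMap.range F) :=
    finiteDimensional_quotient_of_ker_le _ _ hFrange.ge
  have hle : (LinearMap.range Φ.toLinearMap).map F ≤ LinearMap.range Φ.toLinearMap := by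
    rintro _ ⟨_, ⟨q, rfl⟩, rfl⟩
    exact ⟨M (Fin.last n) * q, by simp [F]⟩
  have hI : (Ideal.span (Set.range M)).restrictScalars ℂ =
      ((LinearMap.range Φ.toLinearMap).map F).comap Φ.toLinearMap := by
    ext q
    simp only [Submodule.restrictScalars_mem, Submodule.mem_comap]
    constructor
    · intro hq
      induction hq using Submodule.span_induction with
      | mem x hx =>
        obtain ⟨k, rfl⟩ := hx
        refine Fin.lastCases ?_ (fun k => ?_) k
        · exact ⟨1, ⟨1, by simp⟩, by simp [F]⟩
        · have : Φ (M k.castSucc) = 0 := hJker (Ideal.subset_span ⟨k, rfl⟩)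
          simp [this]
      | zero => simp
      | add x y _ _ hx hy => rw [map_add]; exact Submodule.add_mem _ hx hy
      | smul a x _ hx =>
        obtain ⟨_, ⟨r, rfl⟩, hr⟩ := hx
        refine ⟨_, ⟨a * r, rfl⟩, ?_⟩
        simp only [F, LinearMap.mulLeft_apply, AlgHom.toLinearMap_apply, smul_eq_mul,
          map_mul] at hr ⊢
        rw [← hr]
        ring
    · rintro ⟨_, ⟨r, rfl⟩, hr⟩
      simp only [F, LinearMap.mulLeft_apply, AlgHom.toLinearMap_apply] at hr
      have h1 : q - M (Fin.last n) * r ∈ J := hker (by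
        rw [RingHom.mem_ker, map_sub, map_mul, hr, sub_self])
      have h2 : M (Fin.last n) * r ∈ Ideal.span (Set.range M) :=
        Ideal.mul_mem_right _ _ (Ideal.subset_span ⟨_, rfl⟩)
      simpa using Ideal.add_mem _ (hJle h1) h2
  have hmain := finrank_quotient_eq_of_injective Φ.toLinearMap F hFinj _ hI hle
  have hcoker : Module.finrank ℂ (((Fin n → Fin p) → Polynomial ℂ) ⧸ LinearMap.range F) =
      p ^ (n + 1) := by
    rw [hFrange, ((truncCoeff (Fin n → Fin p) ℂ p).quotKerEquivOfSurjective
      (truncCoeff_surjective _ _ _)).finrank_eq, Module.finrank_pi_fintype]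
    simp [pow_succ]
  rw [← hcoker, ← hmain]
  rfl
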